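/- (Lemma 3.6) Let n > 2m+1 and let h ∈ SO_{2m+1}(F) be semisimple. Then there exist Y ∈ GL_n(F) and X ∈ M_{n×(2m+1)}(F) such that (X, Y) satisfies equation (1.1) and (-1)ⁿ(I_{2m+1} - X'·Y⁻¹·X) is conjugate to h by an element of SO_{2m+1}(F); i.e., the image of the ε-norm correspondence contains all semisimple conjugacy classes of SO_{2m+1}(F). -/

import Mathlib

open Matrix

/-- The `k × k` antidiagonal matrix `w_k` with `(w_k)_{i, k+1-i} = 1` (1-indexed). -/
noncomputable def wMat (F : Type*) [Field F] (k : ℕ) : Matrix (Fin k) (Fin k) F :=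
  Matrix.of fun i j => if (i : ℕ) + (j : ℕ) = k - 1 then 1 else 0

/-- `ε(g) = w_n · ᵗg⁻¹ · w_n⁻¹`. -/
noncomputable def eps (F : Type*) [Field F] (n : ℕ) (g : Matrix (Fin n) (Fin n) F) :
    Matrix (Fin n) (Fin n) F :=
  wMat F n * (g⁻¹)ᵀ * (wMat F n)⁻¹

/-- `ε̃(Y) = w_n · ᵗY · w_n`. -/
noncomputable def epsTilde (F : Type*) [Field F] (n : ℕ) (Y : Matrix (Fin n) (Fin n) F) :
    Matrix (Fin n) (Fin n) F :=
  wMat F n * Yᵀ * wMat F n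

/-- `X' = -w_{2m+1} · ᵗX · w_n`. -/
noncomputable def Xpr (F : Type*) [Field F] (n m : ℕ)
    (X : Matrix (Fin n) (Fin (2 * m + 1)) F) : Matrix (Fin (2 * m + 1)) (Fin n) F :=
  -(wMat F (2 * m + 1)) * Xᵀ * wMat F n

/-- Equation (1.1): `Y + ε̃(Y) = X·X'`. -/
def Eq11 (F : Type*) [Field F] (n m : ℕ)
    (X : Matrix (Fin n) (Fin (2 * m + 1)) F) (Y : Matrix (Fin n) (Fin n) F) : Prop :=
  Y + epsTilde F n Y = X * Xpr F n m X

/-- Membership in `SO_{2m+1}(F)`: `h · w_{2m+1} · ᵗh = w_{2m+1}` and `det h = 1`. -/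
def SOw (F : Type*) [Field F] (k : ℕ) (h : Matrix (Fin k) (Fin k) F) : Prop :=
  h * wMat F k * hᵀ = wMat F k ∧ h.det = 1

/-- Rank factorization: every square matrix is `B * D` with `B` left-invertible and `D`
right-invertible. -/
theorem exists_rank_factorization {F : Type*} [Field F] {N : ℕ} (A : Matrix (Fin N) (Fin N) F) :
    ∃ r ≤ N, ∃ (B : Matrix (Fin N) (Fin r) F) (D L : Matrix (Fin r) (Fin N) F)
      (R : Matrix (Fin N) (Fin r) F), A = B * D ∧ L * B = 1 ∧ D * R = 1 := by
  let f := Matrix.toLin' A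
  let e : LinearMap.range f ≃ₗ[F] (Fin (Module.finrank F (LinearMap.range f)) → F) :=
    (Module.finBasis F (LinearMap.range f)).equivFun
  obtain ⟨l, hl⟩ :=
    ((LinearMap.range f).subtype ∘ₗ e.symm.toLinearMap).exists_leftInverse_of_injective
    (LinearMap.ker_eq_bot.2 (Subtype.val_injective.comp e.symm.injective))
  obtain ⟨s, hs⟩ := (e.toLinearMap ∘ₗ f.rangeRestrict).exists_rightInverse_of_surjective
    (LinearMap.range_eq_top.2 (e.surjective.comp f.surjective_rangeRestrict))
  refine ⟨_, (Submodule.finrank_le _).trans (by simp),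
    LinearMap.toMatrix' ((LinearMap.range f).subtype ∘ₗ e.symm.toLinearMap),
    LinearMap.toMatrix' (e.toLinearMap ∘ₗ f.rangeRestrict),
    LinearMap.toMatrix' l, LinearMap.toMatrix' s, ?_, ?_, ?_⟩
  · rw [← LinearMap.toMatrix'_comp]
    apply Matrix.toLin'.injective
    rw [Matrix.toLin'_toMatrix']
    refine LinearMap.ext fun x => ?_
    simp [f]
  · rw [← LinearMap.toMatrix'_comp, hl, LinearMap.toMatrix'_id]
  · rw [← LinearMap.toMatrix'_comp, hs, LinearMap.toMatrix'_id]

/-- The Wall form of an isometry `g` of the symmetric form `J`: a nondegenerate form `C` of size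
the rank of `g - 1`, from which `g` is recovered. -/
theorem exists_wall_form {F : Type*} [Field F] {N : ℕ} {J g : Matrix (Fin N) (Fin N) F}
    (hJ : J * J = 1) (hJt : Jᵀ = J) (hg : gᵀ * J * g = J) :
    ∃ r ≤ N, ∃ (C : Matrix (Fin r) (Fin r) F) (X : Matrix (Fin r) (Fin N) F),
      IsUnit C ∧ C + Cᵀ = -(X * J * Xᵀ) ∧ g = 1 + J * Xᵀ * C⁻¹ * X := by
  obtain ⟨r, hr, B, D, L, R, hA, hL, hR⟩ := exists_rank_factorization (g - 1)
  have hLt : Bᵀ * Lᵀ = 1 := by rw [← transpose_mul, hL, transpose_one]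
  have hRt : Rᵀ * Dᵀ = 1 := by rw [← transpose_mul, hR, transpose_one]
  have hgBD : g = 1 + B * D := by rw [← hA]; abel
  have key : Dᵀ * (Bᵀ * J) + J * B * D + Dᵀ * (Bᵀ * J * B) * D = 0 := by
    have h1 : gᵀ * J * g - J = 0 := by rw [hg, sub_self]
    rw [← h1, hgBD, transpose_add, transpose_one, transpose_mul]
    simp only [Matrix.add_mul, Matrix.mul_add, Matrix.one_mul, Matrix.mul_one, Matrix.mul_assoc]
    abel
  set C : Matrix (Fin r) (Fin r) F := -(Rᵀ * J * B + Bᵀ * J * B) with hC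
  have hX : Bᵀ * J = C * D := by
    have h1 : Rᵀ * (Dᵀ * (Bᵀ * J) + J * B * D + Dᵀ * (Bᵀ * J * B) * D) = 0 := by
      rw [key, Matrix.mul_zero]
    have h2 : Bᵀ * J + Rᵀ * J * B * D + Bᵀ * J * B * D = 0 := by
      rw [← h1]
      simp only [Matrix.mul_add, ← Matrix.mul_assoc, hRt, Matrix.one_mul]
    rw [hC, Matrix.neg_mul, Matrix.add_mul, eq_neg_iff_add_eq_zero, ← add_assoc, h2]
  have hCinv : C * (D * (J * Lᵀ)) = 1 := by
    rw [← Matrix.mul_assoc, ← hX, Matrix.mul_assoc, ← Matrix.mul_assoc J, hJ, Matrix.one_mul, hLt]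
  have hCu : IsUnit C := IsUnit.of_mul_eq_one _ hCinv
  have hXt : J * B = Dᵀ * Cᵀ := by
    rw [← transpose_mul, ← hX, transpose_mul, hJt, transpose_transpose]
  refine ⟨r, hr, C, Bᵀ * J, hCu, ?_, ?_⟩
  · have h1 : Rᵀ * (Dᵀ * (Bᵀ * J) + J * B * D + Dᵀ * (Bᵀ * J * B) * D) * R = 0 := by
      rw [key, Matrix.mul_zero, Matrix.zero_mul]
    have h2 : C + Cᵀ + Bᵀ * J * B = 0 := by
      rw [hX, hXt] at h1
      rw [hX, Matrix.mul_assoc C]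
      simpa only [Matrix.mul_add, Matrix.add_mul, Matrix.mul_assoc, hR, Matrix.mul_one,
        ← Matrix.mul_assoc Rᵀ Dᵀ, hRt, Matrix.one_mul] using h1
    rw [eq_neg_iff_add_eq_zero, ← h2, transpose_mul, hJt, transpose_transpose,
      Matrix.mul_assoc Bᵀ, hJ, Matrix.mul_one, Matrix.mul_assoc]
  · rw [transpose_mul, hJt, transpose_transpose, ← Matrix.mul_assoc J J, hJ, Matrix.one_mul,
      Matrix.mul_assoc B, hX, ← Matrix.mul_assoc C⁻¹, Matrix.nonsing_inv_mul _
      ((Matrix.isUnit_iff_isUnit_det _).1 hCu), Matrix.one_mul, hgBD]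

/-- The parity of the size of the Wall form is given by the determinant. -/
theorem det_wall_form {F : Type*} [Field F] {N r : ℕ} {J : Matrix (Fin N) (Fin N) F}
    {C : Matrix (Fin r) (Fin r) F} {X : Matrix (Fin r) (Fin N) F} (hC : IsUnit C)
    (hCX : C + Cᵀ = -(X * J * Xᵀ)) : (1 + J * Xᵀ * C⁻¹ * X).det = (-1) ^ r := by
  have hd := (Matrix.isUnit_iff_isUnit_det _).1 hC
  have h1 : 1 + X * (J * Xᵀ * C⁻¹) = -(Cᵀ * C⁻¹) := by
    have h2 : X * J * Xᵀ = -C - Cᵀ := by rw [← neg_eq_iff_eq_neg.2 hCX]; abel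
    rw [← Matrix.mul_assoc, ← Matrix.mul_assoc, h2, Matrix.sub_mul, Matrix.neg_mul,
      Matrix.mul_nonsing_inv _ hd]
    abel
  rw [Matrix.det_one_add_mul_comm, h1, det_neg, det_mul, det_transpose, ← det_mul,
    Matrix.mul_nonsing_inv _ hd, det_one, mul_one, Fintype.card_fin]

/-- A form can be enlarged by a symplectic summand on which `X` vanishes. -/
theorem exists_symplectic_extension {F : Type*} [Field F] {N r s n : ℕ} (hn : n = r + (s + s))
    {J : Matrix (Fin N) (Fin N) F} {C : Matrix (Fin r) (Fin r) F} {X : Matrix (Fin r) (Fin N) F}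
    (hC : IsUnit C) (hCX : C + Cᵀ = -(X * J * Xᵀ)) :
    ∃ (Z : Matrix (Fin n) (Fin n) F) (X₁ : Matrix (Fin n) (Fin N) F),
      IsUnit Z ∧ Z + Zᵀ = -(X₁ * J * X₁ᵀ) ∧ X₁ᵀ * Z⁻¹ * X₁ = Xᵀ * C⁻¹ * X := by
  have hd := (Matrix.isUnit_iff_isUnit_det _).1 hC
  let e : Fin r ⊕ (Fin s ⊕ Fin s) ≃ Fin n :=
    ((Equiv.sumCongr (Equiv.refl _) finSumFinEquiv).trans finSumFinEquiv).trans (finCongr hn.symm)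
  let Z₀ : Matrix (Fin r ⊕ (Fin s ⊕ Fin s)) (Fin r ⊕ (Fin s ⊕ Fin s)) F :=
    fromBlocks C 0 0 (fromBlocks 0 1 (-1) 0)
  let W₀ : Matrix (Fin r ⊕ (Fin s ⊕ Fin s)) (Fin r ⊕ (Fin s ⊕ Fin s)) F :=
    fromBlocks C⁻¹ 0 0 (fromBlocks 0 (-1) 1 0)
  let X₀ : Matrix (Fin r ⊕ (Fin s ⊕ Fin s)) (Fin N) F := fromRows X 0
  have hZW : Z₀ * W₀ = 1 := by
    simp [Z₀, W₀, fromBlocks_multiply, Matrix.mul_nonsing_inv _ hd]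
  have hZW' : Z₀.submatrix e.symm e.symm * W₀.submatrix e.symm e.symm = 1 := by
    rw [submatrix_mul_equiv, hZW, submatrix_one_equiv]
  refine ⟨Z₀.submatrix e.symm e.symm, X₀.submatrix e.symm id, IsUnit.of_mul_eq_one _ hZW', ?_, ?_⟩
  · have h1 : Z₀ + Z₀ᵀ = -(X₀ * J * X₀ᵀ) := by
      simp [Z₀, X₀, fromBlocks_transpose, fromBlocks_add, transpose_fromRows, hCX,
        fromRows_mul]
      ext (i | i) (j | j) <;> simp
    have h2 := congrArg (fun M => M.submatrix e.symm e.symm) h1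
    exact h2
  · rw [Matrix.inv_eq_right_inv hZW', transpose_submatrix, submatrix_mul_equiv, submatrix_mul_equiv]
    simp [W₀, X₀, transpose_fromRows, fromCols_mul_fromBlocks, fromCols_mul_fromRows]

theorem wMat_transpose (F : Type*) [Field F] (k : ℕ) : (wMat F k)ᵀ = wMat F k := by
  ext i j
  simp [wMat, add_comm]

theorem wMat_mul_self (F : Type*) [Field F] (k : ℕ) : wMat F k * wMat F k = 1 := by
  ext i j
  have h1 (x : Fin k) : wMat F k i x = if x = i.rev then 1 else 0 := by
    simp only [wMat, of_apply, Fin.ext_iff, Fin.val_rev]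
    congr 1
    apply propext
    omega
  simp only [Matrix.mul_apply, h1, ite_mul, one_mul, zero_mul, Finset.sum_ite_eq',
    Finset.mem_univ, if_true]
  simp only [wMat, of_apply, one_apply, Fin.ext_iff, Fin.val_rev]
  congr 1
  apply propext
  omega

/-- Lemma 3.6: for `n > 2m+1` and `h ∈ SO_{2m+1}(F)` semisimple, there exist
`Y ∈ GL_n(F)` and `X ∈ M_{n×(2m+1)}(F)` with `(X, Y)` satisfying (1.1) and
`(-1)ⁿ(I - X'Y⁻¹X)` conjugate to `h` by an element of `SO_{2m+1}(F)`. -/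
theorem lemma_3_6 (F : Type*) [Field F] [CharZero F] (n m : ℕ) (hn : 2 * m + 1 < n)
    (h : Matrix (Fin (2 * m + 1)) (Fin (2 * m + 1)) F) (hSO : SOw F (2 * m + 1) h)
    (hss : Squarefree (minpoly F h)) :
    ∃ (Y : Matrix (Fin n) (Fin n) F) (X : Matrix (Fin n) (Fin (2 * m + 1)) F),
      IsUnit Y ∧ Eq11 F n m X Y ∧
      ∃ k : Matrix (Fin (2 * m + 1)) (Fin (2 * m + 1)) F,
        SOw F (2 * m + 1) k ∧
        k⁻¹ * (((-1 : F) ^ n) • (1 - Xpr F n m X * Y⁻¹ * X)) * k = h := by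
  have hJ := wMat_mul_self F (2 * m + 1)
  have hJt := wMat_transpose F (2 * m + 1)
  set J := wMat F (2 * m + 1) with hJdef
  have hw := wMat_mul_self F n
  have hwt := wMat_transpose F n
  obtain ⟨h1, hdet⟩ := hSO
  rw [← hJdef] at h1
  have hsq : ((-1 : F) ^ n) * (-1) ^ n = 1 := by rw [← mul_pow]; simp
  have h2 : hᵀ * J * h = J := by
    have h3 : (h * J) * (hᵀ * J) = 1 := by rw [← Matrix.mul_assoc, h1, hJ]
    have h4 := mul_eq_one_comm.1 h3
    rw [← Matrix.mul_assoc] at h4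
    rw [← Matrix.mul_one (hᵀ * J * h), ← hJ, ← Matrix.mul_assoc, h4, Matrix.one_mul]
  have hg : (((-1 : F) ^ n) • h)ᵀ * J * (((-1 : F) ^ n) • h) = J := by
    simp [transpose_smul, smul_smul, h2, hsq]
  obtain ⟨r, hr, C, X₀, hC, hCX, hgC⟩ := exists_wall_form hJ hJt hg
  have hpar : ((-1 : F) ^ n) = (-1) ^ r := by
    rw [← det_wall_form hC hCX, ← hgC, det_smul, hdet, Fintype.card_fin, mul_one, pow_succ, pow_mul,
      pow_two, hsq, one_pow, one_mul]
  obtain ⟨s, hs⟩ : ∃ s, n = r + (s + s) := by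
    have heven : Even (n + r) := by
      rw [← neg_one_pow_eq_one_iff_even (R := F) (by norm_num), pow_add, ← hpar, hsq]
    obtain ⟨t, ht⟩ := heven
    exact ⟨t - r, by omega⟩
  obtain ⟨Z, X, hZ, hZX, hX⟩ := exists_symplectic_extension hs hC hCX
  have hwu : IsUnit (wMat F n) := IsUnit.of_mul_eq_one _ hw
  refine ⟨Z * wMat F n, X, hZ.mul hwu, ?_, 1, ⟨by simp, det_one⟩, ?_⟩
  · rw [Eq11, epsTilde, Xpr, ← hJdef, transpose_mul, hwt, ← Matrix.mul_assoc, hw, Matrix.one_mul,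
      ← Matrix.add_mul, hZX]
    simp only [Matrix.neg_mul, Matrix.mul_neg, Matrix.mul_assoc]
  · have hwi : (wMat F n)⁻¹ = wMat F n := Matrix.inv_eq_right_inv hw
    have h5 : Xpr F n m X * (Z * wMat F n)⁻¹ * X = -(J * (X₀ᵀ * C⁻¹ * X₀)) := by
      rw [Xpr, ← hJdef, Matrix.mul_inv_rev, hwi, ← Matrix.mul_assoc,
        Matrix.mul_assoc (-J * Xᵀ), hw, Matrix.mul_one, ← hX]
      simp only [Matrix.neg_mul, Matrix.mul_assoc]
    rw [h5, sub_neg_eq_add, ← Matrix.mul_assoc, ← Matrix.mul_assoc, ← hgC]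
    simp [smul_smul, hsq]
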